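/- arXiv:1007.5436 — 2 statements merged into one kernel-verified Lean document; each statement's English description precedes it below -/
import Mathlib

section
/- Let r ≥ 1 be an integer and let 0 ≤ λ ≤ 1 and 0 ≤ b ≤ 1 be real numbers. There exists a constant C > 0 (depending only on r, λ, b) such that for every h > 0 and every x ∈ (0,1) satisfying x - (r/2)·h·φ(x)^λ > 0 and x + (r/2)·h·φ(x)^λ < 1, the iterated integral ∫_{-hφ(x)^λ/2}^{hφ(x)^λ/2} ··· ∫_{-hφ(x)^λ/2}^{hφ(x)^λ/2} φ(x + u_1 + ··· + u_r)^{-rb} du_1 ··· du_r ≤ C h^r φ(x)^{r(λ-b)}. -/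
open MeasureTheory

/-- `φ(x) = √(x(1-x))`. -/
noncomputable def phi (x : ℝ) : ℝ := Real.sqrt (x * (1 - x))

theorem mul_prod_min_rpow_le_add_sum {r : ℕ} (hr : 1 ≤ r) {x a : ℝ} (ha : 0 < a)
    (hax : r * a ≤ x) {u : Fin r → ℝ} (hu : ∀ i, |u i| ≤ a) :
    x * ∏ i, (min 1 (1 + u i / a)) ^ (1 / r : ℝ) ≤ x + ∑ i, u i := by
  have hr0 : (0 : ℝ) < r := by exact_mod_cast hr
  have hx : 0 ≤ x := le_trans (by positivity) hax
  have hz : ∀ i, 0 ≤ min 1 (1 + u i / a) := fun i => by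
    have : -1 ≤ u i / a := by
      rw [le_div_iff₀ ha]; linarith [neg_le_of_abs_le (hu i)]
    exact le_min zero_le_one (by linarith)
  have amgm := Real.geom_mean_le_arith_mean_weighted Finset.univ (fun _ : Fin r => (1 / r : ℝ))
    (fun i => min 1 (1 + u i / a)) (fun _ _ => by positivity)
    (by simp [hr0.ne']) (fun i _ => hz i)
  have term : ∀ i, x * (1 / r * min 1 (1 + u i / a)) ≤ x / r + u i := fun i => by
    have hxr : a ≤ x / r := by rw [le_div_iff₀ hr0]; linarith
    have e : x * (1 / r * min 1 (1 + u i / a)) = x / r * min 1 (1 + u i / a) := by ring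
    rw [e]
    have hxr0 : 0 ≤ x / r := by positivity
    rcases le_total 0 (u i) with h | h
    · have := mul_le_mul_of_nonneg_left (min_le_left 1 (1 + u i / a)) hxr0
      linarith
    · have h1 := mul_le_mul_of_nonneg_left (min_le_right 1 (1 + u i / a)) hxr0
      have h2 : x / r * (u i / a) ≤ a * (u i / a) :=
        mul_le_mul_of_nonpos_right hxr (div_nonpos_of_nonpos_of_nonneg h ha.le)
      rw [mul_div_cancel₀ _ ha.ne'] at h2
      linarith
  calc x * ∏ i, (min 1 (1 + u i / a)) ^ (1 / r : ℝ)
      ≤ x * ∑ i, 1 / r * min 1 (1 + u i / a) := mul_le_mul_of_nonneg_left amgm hx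
    _ = ∑ i, x * (1 / r * min 1 (1 + u i / a)) := Finset.mul_sum _ _ _
    _ ≤ ∑ i, (x / r + u i) := Finset.sum_le_sum fun i _ => term i
    _ = x + ∑ i, u i := by
      rw [Finset.sum_add_distrib]
      simp [mul_div_cancel₀ x hr0.ne']

theorem min_one_add_mul_min_one_sub (t : ℝ) :
    min 1 (1 + t) * min 1 (1 + -t) = 1 - |t| := by
  rcases le_total 0 t with h | h
  · rw [min_eq_left (by linarith), min_eq_right (by linarith), abs_of_nonneg h]; ring
  · rw [min_eq_right (by linarith), min_eq_left (by linarith), abs_of_nonpos h]; ring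

theorem phi_add_sum_rpow_le {r : ℕ} (hr : 1 ≤ r) {x a b : ℝ} (hb : 0 ≤ b) (ha : 0 < a)
    (hx0 : r * a ≤ x) (hx1 : r * a ≤ 1 - x) {u : Fin r → ℝ} (hu : ∀ i, |u i| < a) :
    phi (x + ∑ i, u i) ^ (-(r * b)) ≤
      phi x ^ (-(r * b)) * ∏ i, (1 - |u i / a|) ^ (-(b / 2)) := by
  have hr0 : (0 : ℝ) < r := by exact_mod_cast hr
  have hra : 0 < r * a := by positivity
  have hxpos : 0 < x := hra.trans_le hx0
  have hxlt : 0 < 1 - x := hra.trans_le hx1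
  have ht : ∀ i, |u i / a| < 1 := fun i => by
    rw [abs_div, abs_of_pos ha, div_lt_one ha]; exact hu i
  have hq : ∀ i, 0 < 1 - |u i / a| := fun i => sub_pos.2 (ht i)
  have hm : ∀ i, 0 ≤ min 1 (1 + u i / a) := fun i =>
    le_min zero_le_one (by linarith [neg_lt_of_abs_lt (ht i)])
  have hn : ∀ i, 0 ≤ min 1 (1 + -(u i / a)) := fun i =>
    le_min zero_le_one (by linarith [lt_of_abs_lt (ht i)])
  have h1 := mul_prod_min_rpow_le_add_sum hr ha hx0 fun i => (hu i).le
  have h2 := mul_prod_min_rpow_le_add_sum (u := fun i => -u i) hr ha hx1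
    fun i => by rw [abs_neg]; exact (hu i).le
  simp only [neg_div, Finset.sum_neg_distrib] at h2
  set y := x + ∑ i, u i with hy
  set P := ∏ i, (1 - |u i / a|) ^ (1 / r : ℝ) with hP
  have hPpos : 0 < P := Finset.prod_pos fun i _ => Real.rpow_pos_of_pos (hq i) _
  have key : x * (1 - x) * P ≤ y * (1 - y) := by
    have e : P = (∏ i, (min 1 (1 + u i / a)) ^ (1 / r : ℝ)) *
        ∏ i, (min 1 (1 + -(u i / a))) ^ (1 / r : ℝ) := by
      rw [hP, ← Finset.prod_mul_distrib]
      refine Finset.prod_congr rfl fun i _ => ?_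
      rw [← Real.mul_rpow (hm i) (hn i), min_one_add_mul_min_one_sub]
    have hA : 0 ≤ ∏ i, (min 1 (1 + u i / a)) ^ (1 / r : ℝ) :=
      Finset.prod_nonneg fun i _ => Real.rpow_nonneg (hm i) _
    have hB : 0 ≤ ∏ i, (min 1 (1 + -(u i / a))) ^ (1 / r : ℝ) :=
      Finset.prod_nonneg fun i _ => Real.rpow_nonneg (hn i) _
    have := mul_le_mul h1 (h2.trans_eq (by rw [hy]; ring : _ = 1 - y)) (by positivity)
      ((by positivity : (0 : ℝ) ≤ _).trans h1)
    rw [e]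
    linarith
  have hphi : ∀ z, 0 ≤ z * (1 - z) →
      phi z ^ (-(r * b)) = (z * (1 - z)) ^ (-(r * b / 2)) := fun z hz => by
    rw [phi, Real.sqrt_eq_rpow, ← Real.rpow_mul hz]
    congr 1; ring
  have hxx : 0 < x * (1 - x) := by positivity
  rw [hphi y ((by positivity : (0 : ℝ) ≤ _).trans key), hphi x hxx.le]
  calc (y * (1 - y)) ^ (-(r * b / 2)) ≤ (x * (1 - x) * P) ^ (-(r * b / 2)) :=
        Real.rpow_le_rpow_of_nonpos (by positivity) key (neg_nonpos.2 (by positivity))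
    _ = (x * (1 - x)) ^ (-(r * b / 2)) * ∏ i, (1 - |u i / a|) ^ (-(b / 2)) := by
      rw [Real.mul_rpow hxx.le hPpos.le, hP,
        ← Real.finsetProd_rpow _ _ fun i _ => Real.rpow_nonneg (hq i).le _]
      congr 1
      refine Finset.prod_congr rfl fun i _ => ?_
      rw [← Real.rpow_mul (hq i).le]
      congr 1
      field_simp

theorem intervalIntegrable_one_sub_abs_rpow {s : ℝ} (hs : -1 < s) :
    IntervalIntegrable (fun t : ℝ => (1 - |t|) ^ s) volume (-1) 1 := by
  have h0 : IntervalIntegrable (fun t : ℝ => t ^ s) volume 0 1 :=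
    intervalIntegral.intervalIntegrable_rpow' hs
  have hneg : IntervalIntegrable (fun t : ℝ => (1 - |t|) ^ s) volume (-1) 0 := by
    have h := h0.comp_add_left 1
    norm_num at h
    refine h.congr fun t ht => ?_
    rw [Set.uIoc_of_le (by norm_num)] at ht
    simp only [abs_of_nonpos ht.2, sub_neg_eq_add]
  have hpos : IntervalIntegrable (fun t : ℝ => (1 - |t|) ^ s) volume 0 1 := by
    have h := (h0.comp_sub_left 1).symm
    norm_num at h
    refine h.congr fun t ht => ?_
    rw [Set.uIoc_of_le (by norm_num)] at ht
    simp only [abs_of_pos ht.1]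
  exact hneg.trans hpos

/-- For an integer `r ≥ 1` and reals `0 ≤ λ ≤ 1`, `0 ≤ b ≤ 1`, there is `C > 0` such that
for every `h > 0` and `x ∈ (0,1)` with `x - (r/2)hφ(x)^λ > 0` and `x + (r/2)hφ(x)^λ < 1`,
the `r`-fold iterated integral of `φ(x + u₁ + ⋯ + u_r)^{-rb}` over the cube
`[-hφ(x)^λ/2, hφ(x)^λ/2]^r` is at most `C h^r φ(x)^{r(λ-b)}`. -/
theorem stmt2 (r : ℕ) (hr : 1 ≤ r) (lam b : ℝ) (hl0 : 0 ≤ lam) (hl1 : lam ≤ 1)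
    (hb0 : 0 ≤ b) (hb1 : b ≤ 1) :
    ∃ C : ℝ, 0 < C ∧ ∀ h : ℝ, 0 < h → ∀ x : ℝ, 0 < x → x < 1 →
      0 < x - (r / 2 : ℝ) * h * phi x ^ lam →
      x + (r / 2 : ℝ) * h * phi x ^ lam < 1 →
      (∫ u : Fin r → ℝ in
          Set.univ.pi (fun _ : Fin r =>
            Set.Icc (-(h * phi x ^ lam) / 2) (h * phi x ^ lam / 2)),
          phi (x + ∑ i, u i) ^ (-((r : ℝ) * b)))
        ≤ C * h ^ r * phi x ^ ((r : ℝ) * (lam - b)) := by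
  have hg := intervalIntegrable_one_sub_abs_rpow (s := -(b / 2)) (by linarith)
  set G := ∫ t in (-1 : ℝ)..1, (1 - |t|) ^ (-(b / 2)) with hG
  have hG0 : 0 ≤ G := intervalIntegral.integral_nonneg (by norm_num) fun t ht =>
    Real.rpow_nonneg (sub_nonneg.2 (abs_le.2 ht)) _
  refine ⟨(G / 2) ^ r + 1, by positivity, fun h hh x hx0 hx1 hl hu => ?_⟩
  have hphi : 0 < phi x := Real.sqrt_pos.2 (mul_pos hx0 (sub_pos.2 hx1))
  have hpl : 0 < phi x ^ lam := Real.rpow_pos_of_pos hphi _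
  set a := h * phi x ^ lam / 2 with ha
  have ha0 : 0 < a := by positivity
  have hra : (r / 2 : ℝ) * h * phi x ^ lam = r * a := by rw [ha]; ring
  rw [hra] at hl hu
  rw [neg_div, ← ha, volume_pi,
    ← setIntegral_congr_set Measure.pi_Ioo_ae_eq_pi_Icc,
    Measure.restrict_pi_pi]
  have hga : Integrable (fun t : ℝ => (1 - |t / a|) ^ (-(b / 2)))
      (volume.restrict (Set.Ioo (-a) a)) := by
    have h := hg.comp_mul_left (c := a⁻¹)
    simp only [div_inv_eq_mul, neg_mul, one_mul] at h
    rw [intervalIntegrable_iff_integrableOn_Ioo_of_le (by linarith)] at h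
    simpa only [IntegrableOn, div_eq_inv_mul] using h
  have hint : ∫ t in Set.Ioo (-a) a, (1 - |t / a|) ^ (-(b / 2)) = a * G := by
    rw [← integral_Ioc_eq_integral_Ioo, ← intervalIntegral.integral_of_le (by linarith),
      intervalIntegral.integral_comp_div (fun t : ℝ => (1 - |t|) ^ (-(b / 2))) ha0.ne',
      neg_div, div_self ha0.ne', smul_eq_mul]
  have hmem : ∀ᵐ u ∂Measure.pi fun _ : Fin r => volume.restrict (Set.Ioo (-a) a),
      ∀ i, |u i| < a := by
    rw [← Measure.restrict_pi_pi]
    filter_upwards [ae_restrict_mem (MeasurableSet.univ_pi fun _ => measurableSet_Ioo)]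
      with u hu i using abs_lt.2 (hu i trivial)
  calc _ ≤ ∫ u : Fin r → ℝ, phi x ^ (-(r * b)) * ∏ i, (1 - |u i / a|) ^ (-(b / 2))
          ∂Measure.pi fun _ => volume.restrict (Set.Ioo (-a) a) := by
        refine integral_mono_of_nonneg
          (Filter.Eventually.of_forall fun u => Real.rpow_nonneg (Real.sqrt_nonneg _) _)
          ((Integrable.fintype_prod fun _ => hga).const_mul _) ?_
        filter_upwards [hmem] with u hu'
        exact phi_add_sum_rpow_le hr hb0 ha0 (by linarith) (by linarith) hu'
    _ = phi x ^ (-(r * b)) * (a * G) ^ r := by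
        rw [integral_const_mul,
          integral_fintype_prod_eq_prod (fun _ t => (1 - |t / a|) ^ (-(b / 2)))]
        simp [hint]
    _ = (G / 2) ^ r * h ^ r * phi x ^ ((r : ℝ) * (lam - b)) := by
        have e : phi x ^ ((r : ℝ) * (lam - b)) = (phi x ^ lam) ^ r * phi x ^ (-(r * b)) := by
          rw [← Real.rpow_mul_natCast hphi.le, ← Real.rpow_add hphi]
          congr 1; ring
        rw [e, ha, show h * phi x ^ lam / 2 * G = G / 2 * h * phi x ^ lam by ring,
          mul_pow, mul_pow]
        ring
    _ ≤ _ := by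
        gcongr
        linarith
end

section
/- (Berens–Lorentz lemma) Let r ≥ 1 be an integer and 0 < α₀ < r. Suppose Ω : (0,1] → [0,∞) is nondecreasing and there exists M > 0 such that Ω(h) ≤ M(δ^{α₀} + h^r δ^{-r} Ω(δ)) whenever 0 < h ≤ δ ≤ 1. Then there exists a constant C > 0 such that Ω(t) ≤ C t^{α₀} for all t ∈ (0,1]. -/
/-- **Berens–Lorentz lemma.**  Let `r ≥ 1`, `0 < α₀ < r`, and let `Ω` be a
nondecreasing nonnegative function on `(0,1]` such that for some `M > 0`,
`Ω(h) ≤ M (δ^{α₀} + h^r δ^{-r} Ω(δ))` whenever `0 < h ≤ δ ≤ 1`.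
Then there is `C > 0` with `Ω(t) ≤ C t^{α₀}` for all `t ∈ (0,1]`. -/
theorem stmt13 (r : ℕ) (hr : 1 ≤ r) (a0 : ℝ) (ha0 : 0 < a0) (ha0r : a0 < r)
    (Om : ℝ → ℝ)
    (hnonneg : ∀ t : ℝ, 0 < t → t ≤ 1 → 0 ≤ Om t)
    (hmono : ∀ s t : ℝ, 0 < s → s ≤ t → t ≤ 1 → Om s ≤ Om t)
    (M : ℝ) (hM : 0 < M)
    (hbound : ∀ h δ : ℝ, 0 < h → h ≤ δ → δ ≤ 1 →
      Om h ≤ M * (δ ^ a0 + h ^ r * (δ ^ r)⁻¹ * Om δ)) :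
    ∃ C : ℝ, 0 < C ∧ ∀ t : ℝ, 0 < t → t ≤ 1 → Om t ≤ C * t ^ a0 := by
  obtain ⟨q, hq0, hq1, hqM⟩ : ∃ q : ℝ, 0 < q ∧ q < 1 ∧ M * q ^ ((r : ℝ) - a0) ≤ 1 / 2 := by
    have hc : 0 < (r : ℝ) - a0 := sub_pos.mpr ha0r
    have hb : 0 < (2 * M + 1)⁻¹ := by positivity
    refine ⟨(2 * M + 1)⁻¹ ^ ((r : ℝ) - a0)⁻¹, Real.rpow_pos_of_pos hb _,
      Real.rpow_lt_one hb.le (inv_lt_one_of_one_lt₀ (by linarith)) (inv_pos.mpr hc), ?_⟩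
    rw [Real.rpow_inv_rpow hb.le hc.ne', ← div_eq_mul_inv, div_le_div_iff₀ (by positivity) two_pos]
    linarith
  have hqa : 0 < q ^ a0 := Real.rpow_pos_of_pos hq0 a0
  have hOm1 : 0 ≤ Om 1 := hnonneg 1 one_pos le_rfl
  set C : ℝ := (2 * M + Om 1) / q ^ a0
  have hC0 : 0 < C := by positivity
  have hCq : C * q ^ a0 = 2 * M + Om 1 := div_mul_cancel₀ _ hqa.ne'
  have hqr : M * q ^ r ≤ q ^ a0 / 2 := by
    rw [Real.rpow_sub hq0, Real.rpow_natCast, ← mul_div_assoc, div_le_iff₀ hqa] at hqM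
    linarith
  have key : ∀ n : ℕ, ∀ t : ℝ, q ^ n < t → t ≤ 1 → Om t ≤ C * t ^ a0 := by
    intro n
    induction n with
    | zero =>
      intro t ht ht1
      rw [pow_zero] at ht
      linarith
    | succ n ih =>
      intro t ht ht1
      have ht0 : 0 < t := (pow_pos hq0 _).trans ht
      rcases le_total q t with hqt | htq
      · calc Om t ≤ Om 1 := hmono t 1 ht0 ht1 le_rfl
          _ ≤ C * q ^ a0 := by linarith
          _ ≤ C * t ^ a0 := by gcongr
      · obtain ⟨δ, rfl⟩ : ∃ δ, t = q * δ := ⟨t / q, by field_simp⟩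
        have hδ0 : 0 < δ := pos_of_mul_pos_right ht0 hq0.le
        have hδ1 : δ ≤ 1 := by nlinarith
        have hδn : q ^ n < δ := by
          rw [pow_succ'] at ht
          exact lt_of_mul_lt_mul_left ht hq0.le
        have hδa : 0 < δ ^ a0 := Real.rpow_pos_of_pos hδ0 a0
        have hδr : (q * δ) ^ r * (δ ^ r)⁻¹ = q ^ r := by
          rw [mul_pow, mul_inv_cancel_right₀ (pow_pos hδ0 r).ne']
        have hstep := hbound (q * δ) δ ht0 (by nlinarith) hδ1
        rw [hδr] at hstep
        calc Om (q * δ) ≤ M * δ ^ a0 + M * q ^ r * Om δ := by linarith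
          _ ≤ M * δ ^ a0 + q ^ a0 / 2 * (C * δ ^ a0) := by
            gcongr
            · exact hnonneg δ hδ0 hδ1
            · exact ih δ hδn hδ1
          _ = (M + C * q ^ a0 / 2) * δ ^ a0 := by ring
          _ ≤ C * q ^ a0 * δ ^ a0 := by
            gcongr
            linarith
          _ = C * (q * δ) ^ a0 := by
            rw [Real.mul_rpow hq0.le hδ0.le, mul_assoc]
  refine ⟨C, hC0, fun t ht0 ht1 => ?_⟩
  obtain ⟨n, hn⟩ := exists_pow_lt_of_lt_one ht0 hq1
  exact key n t hn ht1
end
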